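/- arXiv:2203.13135 — 2 statements merged into one kernel-verified Lean document; each statement's English description precedes it below -/
import Mathlib

section
/- Let I be a finite index set and for each i ∈ I let p_i be a nonzero real polynomial. Let a < b be real numbers and let θ* ∈ (a, b) satisfy p_i(θ*) > 0 for every i ∈ I. Suppose that for every i ∈ I, every root of p_i lying in the open interval (a, b) has even multiplicity. Then for all θ ∈ [a, b] and all i ∈ I, p_i(θ) ≥ 0. -/
open Polynomial

/-- A real polynomial that is positive somewhere on `(a, b)` and has no root there is nonnegative
on `[a, b]`. -/
theorem Polynomial.eval_nonneg_of_forall_not_isRoot {p : ℝ[X]} {a b c x : ℝ}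
    (hc : c ∈ Set.Ioo a b) (hpc : 0 < p.eval c) (hroots : ∀ r ∈ Set.Ioo a b, ¬ p.IsRoot r)
    (hx : x ∈ Set.Icc a b) : 0 ≤ p.eval x := by
  by_contra! hneg
  obtain ⟨r, hr, hr0⟩ := intermediate_value_uIcc (a := x) (b := c) p.continuous.continuousOn
    (Set.mem_uIcc.2 (Or.inl ⟨hneg.le, hpc.le⟩))
  refine hroots r ?_ hr0
  have hrx : r ≠ x := by
    rintro rfl
    exact hneg.ne hr0
  obtain ⟨hac, hcb⟩ := hc
  obtain ⟨hax, hxb⟩ := hx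
  rcases Set.mem_uIcc.1 hr with ⟨h1, h2⟩ | ⟨h1, h2⟩
  · exact ⟨hax.trans_lt (lt_of_le_of_ne h1 hrx.symm), h2.trans_lt hcb⟩
  · exact ⟨hac.trans_le h1, (lt_of_le_of_ne h2 hrx).trans_le hxb⟩

/-- A real polynomial that is positive somewhere on `(a, b)` and whose roots in `(a, b)` all have
even multiplicity is nonnegative on `[a, b]`. -/
theorem Polynomial.eval_nonneg_of_even_rootMultiplicity {p : ℝ[X]} {a b c x : ℝ}
    (hc : c ∈ Set.Ioo a b) (hpc : 0 < p.eval c)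
    (hroots : ∀ r ∈ Set.Ioo a b, p.IsRoot r → Even (p.rootMultiplicity r))
    (hx : x ∈ Set.Icc a b) : 0 ≤ p.eval x := by
  induction hn : p.natDegree using Nat.strong_induction_on generalizing p with
  | _ n ih =>
    by_cases hex : ∃ r ∈ Set.Ioo a b, p.IsRoot r
    · obtain ⟨r, hr, hpr⟩ := hex
      have hp : p ≠ 0 := by
        rintro rfl
        simp at hpc
      have heven := hroots r hr hpr
      have hm : 0 < p.rootMultiplicity r := (rootMultiplicity_pos hp).2 hpr
      obtain ⟨q, hpq, hq⟩ := exists_eq_pow_rootMultiplicity_mul_and_not_dvd p hp r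
      generalize p.rootMultiplicity r = m at heven hm hpq
      have hq0 : q ≠ 0 := by
        rintro rfl
        exact hq (dvd_zero _)
      have heval (y : ℝ) : p.eval y = (y - r) ^ m * q.eval y := by simp [hpq]
      rw [heval]
      refine mul_nonneg (heven.pow_nonneg _) (ih q.natDegree ?_ ?_ ?_ rfl)
      · rw [← hn, hpq, natDegree_mul (pow_ne_zero _ (X_sub_C_ne_zero r)) hq0, natDegree_pow,
          natDegree_X_sub_C]
        lia
      · exact pos_of_mul_pos_right (heval c ▸ hpc) (heven.pow_nonneg _)
      · intro s hs hqs
        have hsr : s ≠ r := by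
          rintro rfl
          exact hq (dvd_iff_isRoot.2 hqs)
        have hmult : p.rootMultiplicity s = q.rootMultiplicity s := by
          rw [hpq, rootMultiplicity_mul (hpq ▸ hp), rootMultiplicity_eq_zero, zero_add]
          simp [IsRoot, sub_eq_zero, hsr]
        rw [← hmult]
        refine hroots s hs ?_
        rw [IsRoot, heval, hqs.eq_zero, mul_zero]
    · push Not at hex
      exact eval_nonneg_of_forall_not_isRoot hc hpc hex hx

/-- Finite family version: if each `p i` is positive at `θ* ∈ (a, b)` and all roots
of each `p i` in `(a, b)` have even multiplicity, then every `p i` is nonnegative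
on all of `[a, b]`. -/
theorem family_nonneg_on_Icc_of_even_multiplicity_roots
    (ι : Type*) [Fintype ι]
    (p : ι → Polynomial ℝ) (hp : ∀ i, p i ≠ 0)
    (a b : ℝ) (hab : a < b)
    (θstar : ℝ) (hθ : θstar ∈ Set.Ioo a b) (hpos : ∀ i, 0 < (p i).eval θstar)
    (hroots : ∀ i, ∀ r ∈ Set.Ioo a b, (p i).IsRoot r →
      Even ((p i).rootMultiplicity r)) :
    ∀ θ ∈ Set.Icc a b, ∀ i, 0 ≤ (p i).eval θ := by
  intro θ hmem i
  exact eval_nonneg_of_even_rootMultiplicity hθ (hpos i) (hroots i) hmem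
end

section
/- Let I be a finite index set and for each i ∈ I let p_i be a nonzero real polynomial. Let a < b be real numbers, let θ* ∈ (a, b) satisfy p_i(θ*) > 0 for every i ∈ I, and suppose that for every i ∈ I every root of p_i in the open interval (a, b) has even multiplicity. If in addition b is a root of odd multiplicity of p_j for some j ∈ I, then there exists ε > 0 such that p_j(θ) < 0 for all θ ∈ (b, b + ε). Consequently, the interval returned by Get_Extremes is maximal on the right: no interval of the form [a', b'] with θ* ∈ [a', b'] and b' > b is contained in the set {θ : p_i(θ) ≥ 0 for all i ∈ I}. -/
open Polynomial

namespace Polynomial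

/-- Splitting off the full power of a linear factor at `r` leaves a cofactor not vanishing
at `r`. -/
theorem exists_eq_pow_rootMultiplicity_mul_eval_ne_zero {q : ℝ[X]} (hq : q ≠ 0) (r : ℝ) :
    ∃ g : ℝ[X], q = (X - C r) ^ q.rootMultiplicity r * g ∧ g.eval r ≠ 0 := by
  obtain ⟨g, hg, hdvd⟩ := q.exists_eq_pow_rootMultiplicity_mul_and_not_dvd hq r
  exact ⟨g, hg, fun h => hdvd (dvd_iff_isRoot.mpr h)⟩

/-- A real polynomial all of whose roots in an order-connected set have even multiplicity, and
which is positive somewhere on that set, is nonnegative on it. -/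
theorem eval_nonneg_of_even_rootMultiplicity_s6 {s : Set ℝ} (hs : s.OrdConnected) {t : ℝ}
    (ht : t ∈ s) (q : ℝ[X]) (hpos : 0 < q.eval t)
    (hroots : ∀ r ∈ s, q.IsRoot r → Even (q.rootMultiplicity r)) :
    ∀ x ∈ s, 0 ≤ q.eval x := by
  induction hn : q.natDegree using Nat.strong_induction_on generalizing q with
  | _ n ih =>
    intro x hx
    have hq : q ≠ 0 := by
      rintro rfl
      simp at hpos
    by_cases h : ∃ r ∈ s, q.IsRoot r
    · obtain ⟨r, hr, hroot⟩ := h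
      have heven := hroots r hr hroot
      have hmult : 0 < q.rootMultiplicity r := (rootMultiplicity_pos hq).mpr hroot
      obtain ⟨g, hg, hgr⟩ := exists_eq_pow_rootMultiplicity_mul_eval_ne_zero hq r
      generalize q.rootMultiplicity r = k at heven hmult hg
      have heval : ∀ y, q.eval y = (y - r) ^ k * g.eval y := fun y => by simp [hg]
      have hg0 : g ≠ 0 := by
        rintro rfl
        simp at hgr
      have hdeg : g.natDegree < n := by
        have hd := congrArg natDegree hg
        rw [((monic_X_sub_C r).pow k).natDegree_mul' hg0, natDegree_pow, natDegree_X_sub_C] at hd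
        omega
      have hgpos : 0 < g.eval t := by
        rw [heval] at hpos
        exact pos_of_mul_pos_right hpos (heven.pow_nonneg _)
      have hgroots : ∀ y ∈ s, g.IsRoot y → Even (g.rootMultiplicity y) := by
        intro y hy hgy
        have hyr : y ≠ r := by
          rintro rfl
          exact hgr hgy
        have hlin : ((X - C r) ^ k).rootMultiplicity y = 0 :=
          rootMultiplicity_eq_zero (by simp [sub_ne_zero.mpr hyr])
        have hqy := hroots y hy (by simp [IsRoot, heval, hgy.eq_zero])
        rw [hg] at hqy hq
        rwa [rootMultiplicity_mul hq, hlin, zero_add] at hqy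
      rw [heval]
      exact mul_nonneg (heven.pow_nonneg _) (ih _ hdeg g hgpos hgroots rfl x hx)
    · by_contra! hneg
      obtain ⟨r, hr, hroot⟩ := hs.isPreconnected.intermediate_value hx ht
        q.continuous.continuousOn ⟨hneg.le, hpos.le⟩
      exact h ⟨r, hr, hroot⟩

/-- A real polynomial which is nonnegative just to the left of a root of odd multiplicity is
negative just to the right of it. -/
theorem eventually_eval_neg_of_odd_rootMultiplicity {q : ℝ[X]} (hq : q ≠ 0) {b : ℝ}
    (hodd : Odd (q.rootMultiplicity b)) (hleft : ∀ᶠ x in nhdsWithin b (Set.Iio b), 0 ≤ q.eval x) :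
    ∀ᶠ x in nhdsWithin b (Set.Ioi b), q.eval x < 0 := by
  obtain ⟨g, hg, hgb⟩ := exists_eq_pow_rootMultiplicity_mul_eval_ne_zero hq b
  generalize q.rootMultiplicity b = k at hodd hg
  have heval : ∀ y, q.eval y = (y - b) ^ k * g.eval y := fun y => by simp [hg]
  have hle : g.eval b ≤ 0 := by
    refine le_of_tendsto (g.continuous.continuousWithinAt (s := Set.Iio b)) ?_
    filter_upwards [hleft, self_mem_nhdsWithin] with x hx hxb
    rw [heval] at hx
    exact nonpos_of_mul_nonneg_right hx (hodd.pow_neg (sub_neg.mpr hxb))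
  have hev : ∀ᶠ x in nhdsWithin b (Set.Ioi b), g.eval x < 0 :=
    g.continuous.continuousWithinAt.eventually (gt_mem_nhds (hle.lt_of_ne hgb))
  filter_upwards [hev, self_mem_nhdsWithin] with x hx hxb
  rw [heval]
  exact mul_neg_of_pos_of_neg (pow_pos (sub_pos.mpr hxb) k) hx

end Polynomial

/-- Maximality on the right of the interval returned by `Get_Extremes`: if `b` is
an odd-multiplicity root of some defining polynomial `p j`, then `p j` is negative
just to the right of `b`, and hence no closed interval containing `θ*` and
extending strictly beyond `b` is contained in the feasible set. -/
theorem get_extremes_right_endpoint_maximal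
    (ι : Type*) [Fintype ι]
    (p : ι → Polynomial ℝ) (hp : ∀ i, p i ≠ 0)
    (a b : ℝ) (hab : a < b)
    (θstar : ℝ) (hθ : θstar ∈ Set.Ioo a b) (hpos : ∀ i, 0 < (p i).eval θstar)
    (hroots : ∀ i, ∀ r ∈ Set.Ioo a b, (p i).IsRoot r →
      Even ((p i).rootMultiplicity r))
    (j : ι) (hjroot : (p j).IsRoot b) (hjodd : Odd ((p j).rootMultiplicity b)) :
    (∃ ε > 0, ∀ θ ∈ Set.Ioo b (b + ε), (p j).eval θ < 0) ∧
    (∀ a' b' : ℝ, a' ≤ θstar → θstar ≤ b' → b < b' →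
      ¬ (Set.Icc a' b' ⊆ {θ : ℝ | ∀ i, 0 ≤ (p i).eval θ})) := by
  have hright : ∃ ε > 0, ∀ θ ∈ Set.Ioo b (b + ε), (p j).eval θ < 0 := by
    have hnonneg := eval_nonneg_of_even_rootMultiplicity_s6 Set.ordConnected_Ioo hθ (p j) (hpos j)
      (hroots j)
    have hneg := eventually_eval_neg_of_odd_rootMultiplicity (hp j) hjodd
      (Filter.mem_of_superset (Ioo_mem_nhdsLT hab) hnonneg)
    obtain ⟨c, hc, hsub⟩ := mem_nhdsGT_iff_exists_Ioo_subset.mp hneg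
    exact ⟨c - b, sub_pos.mpr hc, fun θ h => hsub (by simpa using h)⟩
  refine ⟨hright, fun a' b' ha' _ hbb' hsub => ?_⟩
  obtain ⟨ε, hε, hneg⟩ := hright
  obtain ⟨x, hbx, hx⟩ := exists_between (lt_min hbb' (lt_add_of_pos_right b hε))
  have hxmem : x ∈ Set.Icc a' b' :=
    ⟨(ha'.trans hθ.2.le).trans hbx.le, (hx.trans_le (min_le_left _ _)).le⟩
  exact (hneg x ⟨hbx, hx.trans_le (min_le_right _ _)⟩).not_ge (hsub hxmem j)
end
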